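/- For a rank-r (r ≥ 2) Drinfeld module φ over K there is an isomorphism of effective t-motives over K: Hom_K(M_φ, C) ≅ (Λ^{r−1}_{K[t]} M_φ) ⊗ Hom_K(det(M_φ), C), where C is the Carlitz motive. -/

import Mathlib

open TensorProduct

/-- The class of `v₁ ∧ ⋯ ∧ vₙ` in the `n`-th exterior power `⋀[R]^n M`. -/
noncomputable def wedge {R M : Type*} [CommRing R] [AddCommGroup M] [Module R M] (n : ℕ)
    (v : Fin n → M) : ⋀[R]^n M :=
  ⟨ExteriorAlgebra.ιMulti R n v, ExteriorAlgebra.ιMulti_range R n (Set.mem_range_self v)⟩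

/-- The semilinear `τ`-action on the abelian `t`-motive `M_φ` of
`φ(t) = θ + a₁τ + ⋯ + a_r τ^r` (see the paper, Example 2.1(i)). -/
noncomputable def Tphi {K : Type*} [Field K] (φK : K →+* K) (θ : K) {r : ℕ} (a : ℕ → K)
    (v : Fin r → Polynomial K) : Fin r → Polynomial K :=
  fun i =>
    if (i : ℕ) = 0 then
      (Polynomial.X - Polynomial.C θ) * Polynomial.C (a r)⁻¹ *
        (v ⟨r - 1, by have h := i.isLt; omega⟩).map φK
    else
      (v ⟨(i : ℕ) - 1, by have h := i.isLt; omega⟩).map φK -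
        Polynomial.C (a (i : ℕ) * (a r)⁻¹) * (v ⟨r - 1, by have h := i.isLt; omega⟩).map φK

namespace exteriorPower

open Module

variable {R M : Type*} [CommRing R] [AddCommGroup M] [Module R M]

/-- Left exterior multiplication `m ↦ x ↦ m ∧ x`. -/
noncomputable def leftWedge (R M : Type*) [CommRing R] [AddCommGroup M] [Module R M] (n : ℕ) :
    M →ₗ[R] ⋀[R]^n M →ₗ[R] ⋀[R]^(n + 1) M :=
  (alternatingMapLinearEquiv (R := R) (M := M) (n := n)).toLinearMap ∘ₗ
    (ιMulti R (n + 1) (M := M)).curryLeft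

lemma leftWedge_ιMulti (n : ℕ) (m : M) (v : Fin n → M) :
    leftWedge R M n m (ιMulti R n v) = ιMulti R (n + 1) (Matrix.vecCons m v) := by
  simp [leftWedge]

/-- The contraction `x ⊗ h ↦ (m ↦ h (m ∧ x))`. -/
noncomputable def contraction (R M : Type*) [CommRing R] [AddCommGroup M] [Module R M] (n : ℕ) :
    (⋀[R]^n M) ⊗[R] Dual R (⋀[R]^(n + 1) M) →ₗ[R] Dual R M :=
  TensorProduct.lift ((LinearMap.llcomp R M (⋀[R]^(n + 1) M) R).flip ∘ₗ (leftWedge R M n).flip)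

@[simp]
lemma contraction_tmul_apply (n : ℕ) (x : ⋀[R]^n M) (h : Dual R (⋀[R]^(n + 1) M)) (m : M) :
    contraction R M n (x ⊗ₜ h) m = h (leftWedge R M n m x) := rfl

lemma contraction_ιMulti_succAbove {n : ℕ} (b : Basis (Fin (n + 1)) R M) (i : Fin (n + 1)) :
    contraction R M n (ιMulti R n (fun j => b (i.succAbove j)) ⊗ₜ
      alternatingMapLinearEquiv b.det) = (-1 : R) ^ (i : ℕ) • b.coord i := by
  refine b.ext fun k => ?_
  rw [contraction_tmul_apply, leftWedge_ιMulti, alternatingMapLinearEquiv_apply_ιMulti]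
  obtain rfl | ⟨j, rfl⟩ := i.eq_self_or_eq_succAbove k
  · have hperm : Matrix.vecCons (b k) (fun j => b (k.succAbove j)) = b ∘ k.cycleRange.symm := by
      ext j : 1
      refine Fin.cases ?_ (fun j => ?_) j <;> simp
    rw [hperm, AlternatingMap.map_perm]
    simp [b.det_self, Units.smul_def]
  · rw [AlternatingMap.map_eq_zero_of_eq _ _ (i := 0) (j := j.succ) (by simp)
      (Fin.succ_ne_zero j).symm]
    simp

lemma contraction_surjective {n : ℕ} (b : Basis (Fin (n + 1)) R M) :
    Function.Surjective (contraction R M n) := by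
  intro f
  have hf : f = ∑ i, f (b i) • b.coord i := by
    refine b.ext fun k => ?_
    simp
  rw [← LinearMap.mem_range, hf]
  refine Submodule.sum_mem _ fun i _ => Submodule.smul_mem _ _ ?_
  refine ⟨(-1 : R) ^ (i : ℕ) • (ιMulti R n (fun j => b (i.succAbove j)) ⊗ₜ
      alternatingMapLinearEquiv b.det), ?_⟩
  rw [map_smul, contraction_ιMulti_succAbove, smul_smul, ← mul_pow]
  simp

lemma contraction_bijective {n : ℕ} (b : Basis (Fin (n + 1)) R M) :
    Function.Bijective (contraction R M n) := by
  nontriviality R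
  have := Module.Finite.of_basis b
  have := Module.Free.of_basis b
  have hM : finrank R M = n + 1 := by simp [finrank_eq_card_basis b]
  have hrank : finrank R ((⋀[R]^n M) ⊗[R] Dual R (⋀[R]^(n + 1) M)) = finrank R (Dual R M) := by
    simp [finrank_tensorProduct, finrank_eq, hM, Dual, finrank_linearMap]
  exact OrzechProperty.bijective_of_surjective_of_injective
    (LinearEquiv.ofFinrankEq _ _ hrank).toLinearMap _ (LinearEquiv.injective _)
    (contraction_surjective b)

/-- The contraction as an isomorphism, for `M` free of rank `n + 1`. -/
noncomputable def contractionEquiv {n : ℕ} (b : Basis (Fin (n + 1)) R M) :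
    (⋀[R]^n M) ⊗[R] Dual R (⋀[R]^(n + 1) M) ≃ₗ[R] Dual R M :=
  LinearEquiv.ofBijective (contraction R M n) (contraction_bijective b)

@[simp]
lemma contractionEquiv_tmul_apply {n : ℕ} (b : Basis (Fin (n + 1)) R M) (x : ⋀[R]^n M)
    (h : Dual R (⋀[R]^(n + 1) M)) (m : M) :
    contractionEquiv b (x ⊗ₜ h) m = h (leftWedge R M n m x) := rfl

/-- Contraction intertwines semilinear actions as soon as linear forms on `M` are determined by
their values on the image of `T`. -/
lemma contractionEquiv_intertwines {n : ℕ} (b : Basis (Fin (n + 1)) R M) (σ : R →+* R) (c : R)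
    (T : M → M)
    (hT : ∀ f g : Dual R M, (∀ m, f (T m) = g (T m)) → f = g)
    (τH : Dual R M → Dual R M)
    (hτHadd : ∀ h₁ h₂, τH (h₁ + h₂) = τH h₁ + τH h₂)
    (hτH : ∀ h m, τH h (T m) = c * σ (h m))
    (τΛ : ⋀[R]^n M → ⋀[R]^n M)
    (hτΛadd : ∀ x y, τΛ (x + y) = τΛ x + τΛ y)
    (hτΛsl : ∀ (f : R) x, τΛ (f • x) = σ f • τΛ x)
    (hτΛ : ∀ v : Fin n → M, τΛ (ιMulti R n v) = ιMulti R n (fun i => T (v i)))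
    (τD : Dual R (⋀[R]^(n + 1) M) → Dual R (⋀[R]^(n + 1) M))
    (hτD : ∀ h (v : Fin (n + 1) → M),
      τD h (ιMulti R (n + 1) (fun i => T (v i))) = c * σ (h (ιMulti R (n + 1) v)))
    (τW : (⋀[R]^n M) ⊗[R] Dual R (⋀[R]^(n + 1) M) → (⋀[R]^n M) ⊗[R] Dual R (⋀[R]^(n + 1) M))
    (hτWadd : ∀ x y, τW (x + y) = τW x + τW y)
    (hτW : ∀ x h, τW (x ⊗ₜ[R] h) = τΛ x ⊗ₜ[R] τD h)
    (w : (⋀[R]^n M) ⊗[R] Dual R (⋀[R]^(n + 1) M)) :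
    contractionEquiv b (τW w) = τH (contractionEquiv b w) := by
  have hH0 : τH 0 = 0 := by simpa using hτHadd 0 0
  have hΛ0 : τΛ 0 = 0 := by simpa using hτΛadd 0 0
  have hW0 : τW 0 = 0 := by
    simpa only [TensorProduct.zero_tmul, hΛ0] using hτW 0 0
  induction w with
  | zero => simp [hW0, hH0]
  | add x y hx hy => rw [hτWadd, map_add, map_add, hτHadd, hx, hy]
  | tmul x h =>
    rw [hτW]
    refine hT _ _ fun m => ?_
    rw [hτH, contractionEquiv_tmul_apply, contractionEquiv_tmul_apply]
    have hx : x ∈ Submodule.span R (Set.range (ιMulti R n (M := M))) := by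
      rw [ιMulti_span]; trivial
    induction hx using Submodule.span_induction with
    | zero => simp [hΛ0]
    | add x y _ _ hx hy => simp only [hτΛadd, map_add, hx, hy, mul_add]
    | smul f x _ hx => simp only [hτΛsl, map_smul, hx, smul_eq_mul, map_mul, mul_left_comm]
    | mem x hx =>
      obtain ⟨v, rfl⟩ := hx
      rw [hτΛ, leftWedge_ιMulti, leftWedge_ιMulti, ← hτD]
      congr 2
      ext j : 1
      refine Fin.cases ?_ (fun j => ?_) j <;> simp

end exteriorPower

open Polynomial in
lemma Tphi_single_castSucc {K : Type*} [Field K] (φK : K →+* K) (θ : K) {n : ℕ} (a : ℕ → K)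
    (j : Fin n) :
    Tphi φK θ a (Pi.single j.castSucc (1 : K[X])) = Pi.single j.succ 1 := by
  have hlast : (⟨n, n.lt_succ_self⟩ : Fin (n + 1)) ≠ j.castSucc :=
    fun h => j.isLt.ne' (congrArg Fin.val h)
  ext i : 1
  refine Fin.cases ?_ (fun i => ?_) i
  · simp [Tphi, hlast, (Fin.succ_ne_zero j).symm]
  · have hi : (⟨(i : ℕ), i.isLt.trans n.lt_succ_self⟩ : Fin (n + 1)) = i.castSucc := rfl
    obtain rfl | hij := eq_or_ne i j
    · simp [Tphi, hlast, hi]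
    · simp [Tphi, hlast, hi, hij]

open Polynomial in
lemma Tphi_single_last {K : Type*} [Field K] (φK : K →+* K) (θ : K) {n : ℕ} (a : ℕ → K) :
    Tphi φK θ a (Pi.single (Fin.last n) (1 : K[X])) =
      ((X - C θ) * C (a (n + 1))⁻¹) • Pi.single 0 1 -
        ∑ j : Fin n, C (a (j + 1) * (a (n + 1))⁻¹) • Pi.single j.succ 1 := by
  have hlast : (⟨n, n.lt_succ_self⟩ : Fin (n + 1)) = Fin.last n := rfl
  ext i : 1
  refine Fin.cases ?_ (fun i => ?_) i
  · simp [Tphi, hlast, (Fin.succ_ne_zero _).symm]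
  · have hi : (⟨(i : ℕ), i.isLt.trans n.lt_succ_self⟩ : Fin (n + 1)) ≠ Fin.last n :=
      fun h => i.isLt.ne (congrArg Fin.val h)
    simp [Tphi, hlast, hi, Finset.sum_apply, Pi.single_apply]

open Polynomial in
/-- Linear forms are determined by their values on the image of `Tphi`. -/
lemma linearMap_ext_Tphi {K : Type*} [Field K] (φK : K →+* K) (θ : K) {n : ℕ} (a : ℕ → K)
    (ha : a (n + 1) ≠ 0) (f g : (Fin (n + 1) → K[X]) →ₗ[K[X]] K[X])
    (h : ∀ m, f (Tphi φK θ a m) = g (Tphi φK θ a m)) : f = g := by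
  have hsucc (j : Fin n) : f (Pi.single j.succ 1) = g (Pi.single j.succ 1) := by
    simpa only [Tphi_single_castSucc] using h (Pi.single j.castSucc 1)
  have hc : (X - C θ) * C (a (n + 1))⁻¹ ≠ 0 :=
    mul_ne_zero (X_sub_C_ne_zero θ) (C_ne_zero.mpr (inv_ne_zero ha))
  have hzero : f (Pi.single 0 1) = g (Pi.single 0 1) := by
    have := h (Pi.single (Fin.last n) 1)
    simp only [Tphi_single_last, map_sub, map_sum, map_smul, hsucc, sub_left_inj] at this
    exact smul_right_injective _ hc this
  refine (Pi.basisFun K[X] (Fin (n + 1))).ext fun i => ?_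
  rw [Pi.basisFun_apply]
  exact Fin.cases hzero hsucc i

/-- For a rank-`r` (`r ≥ 2`) Drinfeld module `φ` over `K = 𝔽_q(θ)` there is an
isomorphism of effective `t`-motives over `K`
`Hom_K(M_φ, C) ≅ (⋀^{r−1}_{K[t]} M_φ) ⊗ Hom_K(det M_φ, C)`,
where `C` is the Carlitz motive (`τ g = (t−θ) g^{(1)}`).
The internal homs carry the `τ`-action characterized by `(τh)(τm) = τ_C(h m)`;
the exterior power and the tensor product carry the diagonal `τ`-actions.  The
conclusion asserts a `K[t]`-linear isomorphism intertwining the `τ`-actions. -/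
theorem stmt8 {K Fq : Type*} [Field K] [Field Fq] [Fintype Fq] [Algebra Fq K]
    (φK : K →+* K) (hφK : ∀ x : K, φK x = x ^ Fintype.card Fq)
    (θ : K) (hθ : Transcendental Fq θ)
    (r : ℕ) (hr : 2 ≤ r) (a : ℕ → K) (har : a r ≠ 0)
    -- the induced τ-action on the internal hom Hom_K(M_φ, C)
    (τH : ((Fin r → Polynomial K) →ₗ[Polynomial K] Polynomial K) →
          ((Fin r → Polynomial K) →ₗ[Polynomial K] Polynomial K))
    (hτHadd : ∀ h₁ h₂, τH (h₁ + h₂) = τH h₁ + τH h₂)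
    (hτHsl : ∀ (f : Polynomial K) h, τH (f • h) = (f.map φK) • τH h)
    (hτH : ∀ h (mvec : Fin r → Polynomial K),
        τH h (Tphi φK θ a mvec) =
          (Polynomial.X - Polynomial.C θ) * ((h mvec).map φK))
    -- the induced τ-action on ⋀^{r−1} M_φ
    (τΛ : (⋀[Polynomial K]^(r-1) (Fin r → Polynomial K)) →
          (⋀[Polynomial K]^(r-1) (Fin r → Polynomial K)))
    (hτΛadd : ∀ x y, τΛ (x + y) = τΛ x + τΛ y)
    (hτΛsl : ∀ (f : Polynomial K) x, τΛ (f • x) = (f.map φK) • τΛ x)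
    (hτΛ : ∀ v : Fin (r-1) → (Fin r → Polynomial K),
        τΛ (wedge (r-1) v) = wedge (r-1) (fun i => Tphi φK θ a (v i)))
    -- the induced τ-action on Hom_K(det M_φ, C)
    (τD : ((⋀[Polynomial K]^r (Fin r → Polynomial K)) →ₗ[Polynomial K] Polynomial K) →
          ((⋀[Polynomial K]^r (Fin r → Polynomial K)) →ₗ[Polynomial K] Polynomial K))
    (hτDadd : ∀ h₁ h₂, τD (h₁ + h₂) = τD h₁ + τD h₂)
    (hτDsl : ∀ (f : Polynomial K) h, τD (f • h) = (f.map φK) • τD h)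
    (hτD : ∀ h (v : Fin r → (Fin r → Polynomial K)),
        τD h (wedge r (fun i => Tphi φK θ a (v i))) =
          (Polynomial.X - Polynomial.C θ) * ((h (wedge r v)).map φK))
    -- the diagonal τ-action on the tensor product
    (τW : ((⋀[Polynomial K]^(r-1) (Fin r → Polynomial K)) ⊗[Polynomial K]
            ((⋀[Polynomial K]^r (Fin r → Polynomial K)) →ₗ[Polynomial K] Polynomial K)) →
          ((⋀[Polynomial K]^(r-1) (Fin r → Polynomial K)) ⊗[Polynomial K]
            ((⋀[Polynomial K]^r (Fin r → Polynomial K)) →ₗ[Polynomial K] Polynomial K)))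
    (hτWadd : ∀ x y, τW (x + y) = τW x + τW y)
    (hτW : ∀ x h, τW (x ⊗ₜ[Polynomial K] h) = (τΛ x) ⊗ₜ[Polynomial K] (τD h)) :
    ∃ ι : ((⋀[Polynomial K]^(r-1) (Fin r → Polynomial K)) ⊗[Polynomial K]
            ((⋀[Polynomial K]^r (Fin r → Polynomial K)) →ₗ[Polynomial K] Polynomial K))
          ≃ₗ[Polynomial K] ((Fin r → Polynomial K) →ₗ[Polynomial K] Polynomial K),
      ∀ w, ι (τW w) = τH (ι w) := by
  obtain ⟨n, rfl⟩ : ∃ n, r = n + 1 := ⟨r - 1, by omega⟩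
  exact ⟨exteriorPower.contractionEquiv (Pi.basisFun (Polynomial K) (Fin (n + 1))),
    exteriorPower.contractionEquiv_intertwines (n := n) _ (Polynomial.mapRingHom φK)
      (Polynomial.X - Polynomial.C θ) (Tphi φK θ a) (linearMap_ext_Tphi φK θ a har)
      τH hτHadd hτH τΛ hτΛadd hτΛsl hτΛ τD hτD τW hτWadd hτW⟩
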